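/- arXiv:2201.06942 — 2 statements merged into one kernel-verified Lean document; each statement's English description precedes it below -/
import Mathlib

section
/- Let p be a prime with p ≡ 5 (mod 8). Then the rational number Σ_{k=0}^{p−1} (12k+1) · (1/4)_k² (1/8)_k / (k!³ · 4^k) is congruent to 0 modulo p³, i.e., its p-adic valuation is at least 3. -/
open Finset

noncomputable section

/-- The Pochhammer symbol `(a)_k = a(a+1)⋯(a+k-1)` for a rational number `a`. -/
def poch (a : ℚ) (k : ℕ) : ℚ := ∏ j ∈ Finset.range k, (a + j)

section ClearedSum

variable {R S : Type*} [CommRing R] [CommRing S]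

/-- Numerator of the ratio of consecutive terms of the strange `₅F₄` series at `1/4` with
parameters `a / 4`, `a / 8`, `(1 + y) / 4` and `(3 - y) / 4`. -/
def ratioNum (a y : R) (j : ℕ) : R :=
  (a + 4 * j) * (a + 8 * j) * (1 + y + 4 * j) * (3 - y + 4 * j)

/-- Denominator of the ratio of consecutive terms of the series. -/
def ratioDen (a y : R) (j : ℕ) : R :=
  32 * (j + 1) ^ 2 * (7 + a - y + 8 * j) * (5 + a + y + 8 * j)

/-- Product of the first `k` ratio numerators. -/
def numProd (a y : R) (k : ℕ) : R := ∏ j ∈ range k, ratioNum a y j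

/-- The series `∑ k ≤ M, (a + 12 k) ∏ j < k, ratioNum j / ratioDen j` multiplied by
`∏ j < M, ratioDen j`. -/
def clearedSum (a y : R) : ℕ → R
  | 0 => a
  | M + 1 => clearedSum a y M * ratioDen a y M + (a + 12 * (M + 1)) * numProd a y (M + 1)

lemma numProd_succ (a y : R) (k : ℕ) :
    numProd a y (k + 1) = numProd a y k * ratioNum a y k :=
  prod_range_succ _ _

lemma map_numProd (f : R →+* S) (a y : R) (k : ℕ) :
    f (numProd a y k) = numProd (f a) (f y) k := by
  simp [numProd, ratioNum, map_prod, map_ofNat f]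

lemma map_clearedSum (f : R →+* S) (a y : R) (M : ℕ) :
    f (clearedSum a y M) = clearedSum (f a) (f y) M := by
  induction M with
  | zero => rfl
  | succ M ih =>
    simp only [clearedSum, map_add, map_mul, ih, map_numProd]
    simp [ratioDen, map_ofNat f]

lemma clearedSum_reflect (a y : R) (M : ℕ) :
    clearedSum a (2 - y) M = clearedSum a y M := by
  have hnum : ratioNum a (2 - y) = ratioNum a y := by
    funext j; simp only [ratioNum]; ring
  have hden : ratioDen a (2 - y) = ratioDen a y := by
    funext j; simp only [ratioDen]; ring
  induction M with
  | zero => rfl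
  | succ M ih => simp only [clearedSum, ih, hden, numProd, hnum]

/-- The common part of the numerators at `y` and at `y - 8`. -/
def commonProd (a y : R) (k : ℕ) : R :=
  ∏ j ∈ range k, ((a + 4 * j) * (a + 8 * j) * (y - 7 + 4 * j) * (3 - y + 4 * j))

lemma numProd_mul_eq_commonProd (a y : R) (k : ℕ) :
    numProd a y k * ((y - 7) * (y - 3)) =
      commonProd a y k * ((y - 7 + 4 * k) * (y - 3 + 4 * k)) := by
  induction k with
  | zero => simp [numProd, commonProd]
  | succ k ih =>
    rw [numProd_succ, commonProd, prod_range_succ, ← commonProd, mul_right_comm, ih, ratioNum]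
    push_cast
    ring

lemma numProd_sub_eight_mul_eq_commonProd (a y : R) (k : ℕ) :
    numProd a (y - 8) k * ((3 - y) * (7 - y)) =
      commonProd a y k * ((3 - y + 4 * k) * (7 - y + 4 * k)) := by
  induction k with
  | zero => simp [numProd, commonProd]
  | succ k ih =>
    rw [numProd_succ, commonProd, prod_range_succ, ← commonProd, mul_right_comm, ih, ratioNum]
    push_cast
    ring

/-- The contiguous relation `y ↦ y - 8` for the partial sums. -/
lemma clearedSum_sub_eight (a y : R) (M : ℕ) :
    ((7 - y) * (a + y - 3 + 8 * M) * clearedSum a (y - 8) M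
      - (y - 3) * (7 + a - y + 8 * M) * clearedSum a y M) * ((y - 7) * (y - 3))
      = 2 * (y - 5) * commonProd a y (M + 1) := by
  induction M with
  | zero => simp [clearedSum, commonProd]; ring
  | succ M ih =>
    have h₁ := numProd_mul_eq_commonProd a y (M + 1)
    have h₂ := numProd_sub_eight_mul_eq_commonProd a y (M + 1)
    rw [commonProd, prod_range_succ, ← commonProd]
    simp only [clearedSum, ratioDen]
    push_cast at h₁ h₂ ih ⊢
    linear_combination
      (32 * ((M : R) + 1) ^ 2 * (a + y + 5 + 8 * M) * (15 + a - y + 8 * M)) * ih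
      + ((7 - y) * (a + y + 5 + 8 * M) * (a + 12 * (M + 1))) * h₂
      - ((y - 3) * (15 + a - y + 8 * M) * (a + 12 * (M + 1))) * h₁

lemma clearedSum_eq_mul_prod (a y : R) {L M : ℕ} (hLM : L ≤ M)
    (h : ∀ k, L < k → numProd a y k = 0) :
    clearedSum a y M = clearedSum a y L * ∏ j ∈ Ico L M, ratioDen a y j := by
  induction M, hLM using Nat.le_induction with
  | base => simp
  | succ M hLM ih =>
    rw [clearedSum, h (M + 1) (by omega), ih, prod_Ico_succ_top hLM]
    ring

lemma numProd_eq_zero {a y : R} {j k : ℕ} (hjk : j < k) (hj : ratioNum a y j = 0) :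
    numProd a y k = 0 :=
  prod_eq_zero (mem_range.2 hjk) hj

end ClearedSum

/-- If `(1 + y) / 4` is a negative odd integer, then the series sums to zero. -/
lemma eventually_clearedSum_eq_zero (a : ℤ) (n : ℕ) :
    ∀ᶠ M in Filter.atTop, clearedSum a (-5 - 8 * n : ℤ) M = 0 := by
  induction n with
  | zero =>
    filter_upwards [Filter.eventually_ge_atTop 1] with M hM
    rw [clearedSum_eq_mul_prod _ _ hM]
    · simp [clearedSum, numProd, ratioNum, ratioDen]; left; ring
    · intro k hk
      exact numProd_eq_zero hk (by simp [ratioNum])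
  | succ n ih =>
    filter_upwards [ih, Filter.eventually_ge_atTop (2 * n + 3 + a.natAbs)] with M hM hM'
    have h := clearedSum_sub_eight a (-5 - 8 * n : ℤ) M
    have hzero : commonProd a (-5 - 8 * n : ℤ) (M + 1) = 0 :=
      prod_eq_zero (i := 2 * n + 3) (mem_range.2 (by omega)) (by push_cast; ring)
    rw [hM, hzero, mul_zero, mul_zero, sub_zero] at h
    have hy : (-5 - 8 * (n : ℤ)) - 8 = -5 - 8 * ((n + 1 : ℕ) : ℤ) := by push_cast; ring
    rw [hy] at h
    simp only [mul_eq_zero] at h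
    rcases h with ((h | h) | h) | h | h
    · omega
    · omega
    · exact h
    · omega
    · omega

lemma clearedSum_eq_zero_of_ratioDen_ne_zero (a : ℤ) (n L : ℕ)
    (hnum : ∀ k, L < k → numProd a (-5 - 8 * n : ℤ) k = 0)
    (hden : ∀ j, L ≤ j → ratioDen a (-5 - 8 * n : ℤ) j ≠ 0) :
    clearedSum a (-5 - 8 * n : ℤ) L = 0 := by
  obtain ⟨M, hM, hLM⟩ :=
    ((eventually_clearedSum_eq_zero a n).and (Filter.eventually_ge_atTop L)).exists
  rw [clearedSum_eq_mul_prod _ _ hLM hnum] at hM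
  refine (mul_eq_zero.1 hM).resolve_right (prod_ne_zero_iff.2 fun j hj => hden j ?_)
  exact (mem_Ico.1 hj).1

lemma clearedSum_one_eq_zero (n M : ℕ) (hM : 2 * n + 1 ≤ M) :
    clearedSum 1 (-5 - 8 * n : ℤ) M = 0 := by
  refine clearedSum_eq_zero_of_ratioDen_ne_zero 1 n M (fun k hk => ?_) (fun j _ => ?_)
  · refine numProd_eq_zero (j := 2 * n + 1) (by omega) ?_
    rw [ratioNum]; push_cast; ring
  · simp only [ratioDen, ne_eq, mul_eq_zero, not_or]
    refine ⟨⟨⟨by norm_num, by positivity⟩, by omega⟩, by omega⟩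

/-- If `a / 4` is a negative odd integer, then the series vanishes identically in `y`. -/
lemma clearedSum_X_eq_zero (t M : ℕ) (hM : 2 * t + 1 ≤ M) :
    clearedSum (Polynomial.C (-4 - 8 * t : ℤ)) Polynomial.X M = 0 := by
  have hnum (k : ℕ) (hk : 2 * t + 1 < k) {R : Type} [CommRing R] (y : R) :
      numProd (-4 - 8 * t : R) y k = 0 :=
    numProd_eq_zero hk (by rw [ratioNum]; push_cast; ring)
  suffices h : clearedSum (Polynomial.C (-4 - 8 * t : ℤ)) Polynomial.X (2 * t + 1) = 0 by
    rw [clearedSum_eq_mul_prod _ _ hM fun k hk => ?_, h, zero_mul]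
    simpa using hnum k hk (Polynomial.X : Polynomial ℤ)
  refine Polynomial.eq_zero_of_infinite_isRoot _ ?_
  refine (Set.infinite_range_of_injective
    (f := fun i : ℕ => (-5 - 8 * ((t + i : ℕ) : ℤ))) fun i j hij => ?_).mono ?_
  · simp only at hij; omega
  · rintro _ ⟨i, rfl⟩
    have := map_clearedSum (Polynomial.evalRingHom (-5 - 8 * ((t + i : ℕ) : ℤ)))
      (Polynomial.C (-4 - 8 * t : ℤ)) Polynomial.X (2 * t + 1)
    simp only [Polynomial.coe_evalRingHom, Polynomial.eval_C, Polynomial.eval_X] at this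
    rw [Set.mem_ofPred_eq, Polynomial.IsRoot, this]
    refine clearedSum_eq_zero_of_ratioDen_ne_zero _ _ _ (fun k hk => ?_) (fun j hj => ?_)
    · simpa using hnum k hk (-5 - 8 * ((t + i : ℕ) : ℤ))
    · simp only [ratioDen, ne_eq, mul_eq_zero, not_or]
      refine ⟨⟨⟨by norm_num, by positivity⟩, by omega⟩, by omega⟩

/-- An integer polynomial divisible by `p` with roots `-p` and `3p` has constant term
divisible by `p ^ 3`. -/
lemma Polynomial.pow_three_dvd_eval_zero {p : ℤ} (hp : p ≠ 0) {G : Polynomial ℤ}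
    (hG : Polynomial.C p ∣ G) (h₁ : G.eval (-p) = 0) (h₂ : G.eval (3 * p) = 0) :
    p ^ 3 ∣ G.eval 0 := by
  obtain ⟨L, rfl⟩ := hG
  simp only [Polynomial.eval_mul, Polynomial.eval_C, mul_eq_zero, hp, false_or] at h₁ h₂
  obtain ⟨L, rfl⟩ := Polynomial.dvd_iff_isRoot.2 h₁
  have h₃ : L.eval (3 * p) = 0 := by
    simp only [Polynomial.eval_mul, mul_eq_zero] at h₂
    refine h₂.resolve_left ?_
    simp only [Polynomial.eval_sub, Polynomial.eval_X, Polynomial.eval_C]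
    omega
  obtain ⟨L, rfl⟩ := Polynomial.dvd_iff_isRoot.2 h₃
  exact ⟨-3 * L.eval 0, by simp; ring⟩

lemma pow_three_dvd_clearedSum (t : ℕ) (hp : (8 * t + 5).Prime) :
    ((8 * t + 5 : ℕ) : ℤ) ^ 3 ∣ clearedSum 1 0 (6 * t + 3) := by
  have := Fact.mk hp
  have heval (z : ℤ) : (clearedSum (1 : Polynomial ℤ) Polynomial.X (6 * t + 3)).eval z
      = clearedSum 1 z (6 * t + 3) := by
    simpa using map_clearedSum (Polynomial.evalRingHom z) 1 Polynomial.X (6 * t + 3)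
  rw [← heval]
  refine Polynomial.pow_three_dvd_eval_zero (by positivity) ?_ ?_ ?_
  · have hmap : (clearedSum (1 : Polynomial ℤ) Polynomial.X (6 * t + 3)).map
        (Int.castRingHom (ZMod (8 * t + 5))) = 0 := by
      have h := congrArg (Polynomial.mapRingHom (Int.castRingHom (ZMod (8 * t + 5))))
        (clearedSum_X_eq_zero t (6 * t + 3) (by omega))
      have hone : Int.castRingHom (ZMod (8 * t + 5)) (-4 - 8 * t : ℤ) = 1 := by
        have h0 : ((8 * t + 5 : ℕ) : ZMod (8 * t + 5)) = 0 := ZMod.natCast_self _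
        push_cast at h0
        simp only [eq_intCast]
        push_cast
        linear_combination -h0
      rw [map_clearedSum, Polynomial.coe_mapRingHom, Polynomial.map_C, hone, Polynomial.map_X,
        Polynomial.map_zero] at h
      rw [← Polynomial.coe_mapRingHom, map_clearedSum, map_one, Polynomial.coe_mapRingHom,
        Polynomial.map_X]
      simpa using h
    rw [Polynomial.C_dvd_iff_dvd_coeff]
    intro i
    have hi := congrArg (fun P => P.coeff i) hmap
    simpa only [Polynomial.coeff_map, Polynomial.coeff_zero, eq_intCast,
      ZMod.intCast_zmod_eq_zero_iff_dvd] using hi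
  · rw [heval]
    convert clearedSum_one_eq_zero t (6 * t + 3) (by omega) using 2
    push_cast; ring
  · rw [heval, ← clearedSum_reflect]
    convert clearedSum_one_eq_zero (3 * t + 1) (6 * t + 3) (by omega) using 2
    push_cast; ring

lemma poch_succ (a : ℚ) (k : ℕ) : poch a (k + 1) = poch a k * (a + k) :=
  prod_range_succ _ _

lemma poch_mul_prod_ratioDen (k : ℕ) :
    poch (1 / 4) k ^ 2 * poch (1 / 8) k * ∏ j ∈ range k, ratioDen (1 : ℚ) 0 j
      = numProd (1 : ℚ) 0 k * ((k.factorial : ℚ) ^ 3 * 4 ^ k) := by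
  induction k with
  | zero => simp [poch, numProd]
  | succ k ih =>
    rw [poch_succ, poch_succ, prod_range_succ, numProd_succ, Nat.factorial_succ, ratioDen,
      ratioNum]
    push_cast
    linear_combination
      (4 * (1 + 4 * k) ^ 2 * (1 + 8 * k) * (3 + 4 * k) * ((k : ℚ) + 1) ^ 3) * ih

/-- The `k`-th term of the sum in the theorem. -/
def seriesTerm (k : ℕ) : ℚ :=
  (12 * (k : ℚ) + 1) * (poch (1 / 4) k ^ 2 * poch (1 / 8) k) /
    ((k.factorial : ℚ) ^ 3 * 4 ^ k)

lemma seriesTerm_mul_prod_ratioDen (k : ℕ) :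
    seriesTerm k * ∏ j ∈ range k, ratioDen (1 : ℚ) 0 j
      = (1 + 12 * k) * numProd (1 : ℚ) 0 k := by
  have hk : ((k.factorial : ℚ) ^ 3 * 4 ^ k) ≠ 0 := by positivity
  rw [seriesTerm, div_mul_eq_mul_div, div_eq_iff hk]
  linear_combination (12 * (k : ℚ) + 1) * poch_mul_prod_ratioDen k

lemma sum_seriesTerm_mul_prod_ratioDen (M : ℕ) :
    (∑ k ∈ range (M + 1), seriesTerm k) * ∏ j ∈ range M, ratioDen (1 : ℚ) 0 j
      = clearedSum (1 : ℚ) 0 M := by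
  induction M with
  | zero => simp [clearedSum, seriesTerm, poch]
  | succ M ih =>
    have h := seriesTerm_mul_prod_ratioDen (M + 1)
    rw [sum_range_succ, add_mul, h, prod_range_succ, ← mul_assoc, ih, clearedSum]
    push_cast
    ring

lemma poch_one_div (c k : ℕ) (hc : c ≠ 0) :
    poch (1 / c) k * (c : ℚ) ^ k = ((∏ j ∈ range k, (1 + c * j) : ℕ) : ℚ) := by
  have hc' : (c : ℚ) ≠ 0 := by exact_mod_cast hc
  induction k with
  | zero => simp [poch]
  | succ k ih =>
    rw [poch_succ, prod_range_succ, Nat.cast_mul, ← ih]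
    push_cast
    field_simp
    ring

/-- The rational number `x` is `p ^ 3` times a fraction with denominator prime to `p`. -/
def CubeDvd (p : ℕ) (x : ℚ) : Prop :=
  ∃ n d : ℤ, ¬ (p : ℤ) ∣ d ∧ x * d = p ^ 3 * n

lemma CubeDvd.add {p : ℕ} (hp : p.Prime) {x y : ℚ} (hx : CubeDvd p x) (hy : CubeDvd p y) :
    CubeDvd p (x + y) := by
  obtain ⟨n, d, hd, h⟩ := hx
  obtain ⟨n', d', hd', h'⟩ := hy
  refine ⟨n * d' + n' * d, d * d', (Nat.prime_iff_prime_int.1 hp).not_dvd_mul hd hd', ?_⟩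
  push_cast
  linear_combination (d' : ℚ) * h + (d : ℚ) * h'

lemma CubeDvd.sum {p : ℕ} (hp : p.Prime) {s : Finset ℕ} {f : ℕ → ℚ}
    (h : ∀ k ∈ s, CubeDvd p (f k)) : CubeDvd p (∑ k ∈ s, f k) :=
  sum_induction f (CubeDvd p) (fun _ _ => CubeDvd.add hp)
    ⟨0, 1, (Nat.prime_iff_prime_int.1 hp).not_dvd_one, by simp⟩ h

lemma CubeDvd.exists_eq {p : ℕ} {x : ℚ} (h : CubeDvd p x) :
    ∃ s : ℚ, x = (p : ℚ) ^ 3 * s ∧ ¬ p ∣ s.den := by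
  obtain ⟨n, d, hd, h⟩ := h
  have hd0 : (d : ℚ) ≠ 0 := by
    rintro h0
    exact hd (by simp [Int.cast_eq_zero.1 h0])
  refine ⟨n / d, by field_simp; linear_combination h, fun hp => hd ?_⟩
  refine (Int.natCast_dvd_natCast.2 hp).trans ?_
  rw [← Rat.divInt_eq_div]
  exact Rat.den_dvd n d

lemma cubeDvd_sum_seriesTerm (t : ℕ) (hp : (8 * t + 5).Prime) :
    CubeDvd (8 * t + 5) (∑ k ∈ range (6 * t + 3 + 1), seriesTerm k) := by
  obtain ⟨n, hn⟩ := pow_three_dvd_clearedSum t hp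
  have hp' := Nat.prime_iff_prime_int.1 hp
  refine ⟨n, ∏ j ∈ range (6 * t + 3), ratioDen (1 : ℤ) 0 j, fun h => ?_, ?_⟩
  · obtain ⟨j, hj, hdvd⟩ := hp'.exists_mem_finset_dvd h
    rw [mem_range] at hj
    have hden : ratioDen (1 : ℤ) 0 j
        = ((2 ^ 9 * (j + 1) * (j + 1) * (j + 1) * (3 + 4 * j) : ℕ) : ℤ) := by
      rw [ratioDen]; push_cast; ring
    rw [hden, Int.natCast_dvd_natCast] at hdvd
    simp only [hp.dvd_mul] at hdvd
    have hsucc : ¬ 8 * t + 5 ∣ j + 1 := Nat.not_dvd_of_pos_of_lt (by omega) (by omega)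
    have htwo : ¬ 8 * t + 5 ∣ 2 ^ 9 := fun h2 =>
      absurd (Nat.le_of_dvd two_pos (hp.dvd_of_dvd_pow h2)) (by omega)
    have hlast : ¬ 8 * t + 5 ∣ 3 + 4 * j := by
      rintro ⟨q, hq⟩
      have hq3 : q < 3 := by
        by_contra! hq3
        nlinarith
      interval_cases q <;> omega
    tauto
  · have h := sum_seriesTerm_mul_prod_ratioDen (6 * t + 3)
    have hcast := map_clearedSum (Int.castRingHom ℚ) 1 0 (6 * t + 3)
    rw [map_one, map_zero, ← h, hn] at hcast
    simp only [eq_intCast] at hcast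
    push_cast at hcast ⊢
    rw [hcast]
    congr 1
    refine prod_congr rfl fun j _ => ?_
    simp only [ratioDen]
    push_cast
    ring

lemma cubeDvd_seriesTerm (t k : ℕ) (hp : (8 * t + 5).Prime) (hk : 6 * t + 3 < k)
    (hkp : k < 8 * t + 5) : CubeDvd (8 * t + 5) (seriesTerm k) := by
  obtain ⟨u, hu⟩ : 8 * t + 5 ∣ ∏ j ∈ range k, (1 + 4 * j) :=
    Dvd.dvd.trans ⟨1, by ring⟩ (dvd_prod_of_mem _ (mem_range.2 (by omega : 2 * t + 1 < k)))
  obtain ⟨v, hv⟩ : 8 * t + 5 ∣ ∏ j ∈ range k, (1 + 8 * j) :=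
    Dvd.dvd.trans ⟨5, by ring⟩ (dvd_prod_of_mem _ (mem_range.2 (by omega : 5 * t + 3 < k)))
  have h4 := poch_one_div 4 k (by norm_num)
  have h8 := poch_one_div 8 k (by norm_num)
  rw [hu] at h4
  rw [hv] at h8
  refine ⟨(12 * k + 1) * u ^ 2 * v,
    ((2 ^ (9 * k) * k.factorial ^ 3 : ℕ) : ℤ), fun h => ?_, ?_⟩
  · rw [Int.natCast_dvd_natCast, hp.dvd_mul] at h
    rcases h with h | h
    · exact absurd (Nat.le_of_dvd two_pos (hp.dvd_of_dvd_pow h)) (by omega)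
    · exact absurd ((hp.dvd_factorial).1 (hp.dvd_of_dvd_pow h)) (by omega)
  · have hf : (k.factorial : ℚ) ≠ 0 := by positivity
    have hpow : (2 : ℚ) ^ (9 * k) = 4 ^ k * (4 ^ k) ^ 2 * 8 ^ k := by
      rw [← pow_mul, mul_comm k 2, pow_mul 4 2 k, ← mul_pow, ← mul_pow, pow_mul]; norm_num
    have hterm : seriesTerm k * (((2 ^ (9 * k) * k.factorial ^ 3 : ℕ) : ℤ) : ℚ)
        = (12 * k + 1) * (poch (1 / 4) k * 4 ^ k) ^ 2 * (poch (1 / 8) k * 8 ^ k) := by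
      rw [seriesTerm]
      push_cast
      rw [hpow]
      field_simp
    push_cast at h4 h8
    rw [hterm, h4, h8]
    push_cast
    ring

/-- For a prime `p ≡ 5 (mod 8)`,
`Σ_{k=0}^{p-1} (12k+1) (1/4)_k² (1/8)_k / (k!³ 4^k)` is `p³` times a rational number
whose denominator is not divisible by `p`. -/
theorem stmt4 (p : ℕ) (hp : p.Prime) (hmod : p % 8 = 5) :
    ∃ s : ℚ,
      (∑ k ∈ Finset.range p,
        (12 * (k : ℚ) + 1) * (poch (1 / 4) k ^ 2 * poch (1 / 8) k) /
          ((k.factorial : ℚ) ^ 3 * 4 ^ k))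
        = (p : ℚ) ^ 3 * s ∧ ¬ (p ∣ s.den) := by
  obtain ⟨t, rfl⟩ : ∃ t, p = 8 * t + 5 := ⟨p / 8, by omega⟩
  change ∃ s : ℚ, ∑ k ∈ range (8 * t + 5), seriesTerm k = _ ∧ _
  refine CubeDvd.exists_eq ?_
  rw [← sum_range_add_sum_Ico _ (by omega : 6 * t + 3 + 1 ≤ 8 * t + 5)]
  refine CubeDvd.add hp (cubeDvd_sum_seriesTerm t hp) (CubeDvd.sum hp fun k hk => ?_)
  rw [mem_Ico] at hk
  exact cubeDvd_seriesTerm t k hp (by omega) hk.2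

end
end

section
/- Let d ≥ 2 be an even integer and e an indeterminate. Let n be a positive integer with n ≡ d+1 (mod 2d). Set M = (n−1)/2 if d = 2, and M = (dn−n+1)/(2d) if d ≥ 4. Then Σ_{k=0}^{M} [3dk−1]_q · (q^{−1},e,q^{d−1}/e; q^{2d})_k (q,q,q^{d−3}; q^d)_k / ((q^d,e,q^{d−1}/e; q^d)_k (q^{2d−2},q^{2d−2},q^{d+2}; q^{2d})_k) · q^{dk} ≡ 0 (mod Φ_n(q)^3), as a congruence of rational functions in q and e. -/
open Finset

noncomputable section

abbrev R2 : Type := MvPolynomial (Fin 2) ℚ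
abbrev K2 : Type := FractionRing R2

/-- The variable `q` as a rational function in `ℚ(q,e)`. -/
def qv : K2 := algebraMap R2 K2 (MvPolynomial.X 0)

/-- The indeterminate `e` as a rational function in `ℚ(q,e)`. -/
def ev : K2 := algebraMap R2 K2 (MvPolynomial.X 1)

/-- The q-shifted factorial `(a; q)_k = (1-a)(1-aq)⋯(1-aq^{k-1})`. -/
def qPoch {R : Type*} [CommRing R] (a q : R) (k : ℕ) : R :=
  ∏ j ∈ Finset.range k, (1 - a * q ^ j)

/-- The q-integer `[m]_q = (1 - q^m)/(1 - q)`. -/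
def qInt {K : Type*} [Field K] (q : K) (m : ℤ) : K := (1 - q ^ m) / (1 - q)

/-- The n-th cyclotomic polynomial `Φ_n(q)` viewed inside `ℚ[q,e]`. -/
def Phi2 (n : ℕ) : R2 := Polynomial.aeval (MvPolynomial.X 0) (Polynomial.cyclotomic n ℚ)

/-- `A ≡ B (mod M)`: the polynomial `M` divides the numerator of the reduced form
of the rational function `A - B`. -/
def CongrMod2 (A B : K2) (M : R2) : Prop :=
  ∃ f g : R2, g ≠ 0 ∧ (∀ p : R2, Prime p → p ∣ g → ¬ p ∣ M) ∧
    (A - B) * algebraMap R2 K2 g = algebraMap R2 K2 M * algebraMap R2 K2 f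


/-- Numerator factor of the term ratio in Rahman's quadratic summation in base `Q`. With `e`, `b`, `c`
the remaining parameters, `E = e + aQ/e`, `g = bc`, `h = a/(bc)` and `s = b + c`. -/
def rahmanNum {R : Type*} [CommRing R] (Q a E g h s : R) (j : ℕ) : R :=
  (1 - a * Q ^ (2 * j)) * (1 - E * Q ^ (2 * j) + a * Q ^ (4 * j + 1)) *
    (1 - s * Q ^ j + g * Q ^ (2 * j)) * (1 - h * Q ^ (j + 1))

/-- Denominator factor of the term ratio in Rahman's quadratic summation. -/
def rahmanDen {R : Type*} [CommRing R] (Q a E g h s : R) (j : ℕ) : R :=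
  (1 - Q ^ (j + 1)) * (1 - E * Q ^ j + a * Q ^ (2 * j + 1)) *
    (1 - h * s * Q ^ (2 * j + 2) + h * a * Q ^ (4 * j + 4)) * (1 - g * Q ^ (2 * j + 1))

/-- Rahman's quadratic sum truncated at `K`, cleared of denominators. -/
def rahmanSum {R : Type*} [CommRing R] (Q a E g h s : R) (K : ℕ) : R :=
  ∑ k ∈ range (K + 1), (1 - a * Q ^ (3 * k)) * Q ^ k *
    (∏ j ∈ range k, rahmanNum Q a E g h s j) * ∏ j ∈ Ico k K, rahmanDen Q a E g h s j

section CommRing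

variable {R S : Type*} [CommRing R] [CommRing S]

lemma map_rahmanSum (φ : R →+* S) (Q a E g h s : R) (K : ℕ) :
    φ (rahmanSum Q a E g h s K) = rahmanSum (φ Q) (φ a) (φ E) (φ g) (φ h) (φ s) K := by
  simp [rahmanSum, rahmanNum, rahmanDen, map_sum, map_prod]

lemma rahmanSum_zero (Q a E g h s : R) : rahmanSum Q a E g h s 0 = 1 - a := by
  simp [rahmanSum]

lemma rahmanSum_succ (Q a E g h s : R) (K : ℕ) :
    rahmanSum Q a E g h s (K + 1) = rahmanSum Q a E g h s K * rahmanDen Q a E g h s K +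
      (1 - a * Q ^ (3 * (K + 1))) * Q ^ (K + 1) *
        ∏ j ∈ range (K + 1), rahmanNum Q a E g h s j := by
  rw [rahmanSum, sum_range_succ, Ico_self, prod_empty, mul_one, rahmanSum, sum_mul]
  congr 1
  refine sum_congr rfl fun k hk => ?_
  rw [prod_Ico_succ_top (by simpa [Nat.lt_succ_iff] using hk)]
  ring

lemma rahmanSum_of_rahmanNum_eq_zero {Q a E g h s : R} {N K : ℕ}
    (hN : rahmanNum Q a E g h s N = 0) (hK : N ≤ K) :
    rahmanSum Q a E g h s K =
      rahmanSum Q a E g h s N * ∏ j ∈ Ico N K, rahmanDen Q a E g h s j := by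
  induction K, hK using Nat.le_induction with
  | base => simp
  | succ K hK ih =>
    rw [rahmanSum_succ, ih, prod_Ico_succ_top hK,
      prod_eq_zero (mem_range.2 (Nat.lt_succ_of_le hK)) hN]
    ring

/-- At the zero `E = Q⁻ⁱ + aQⁱ⁺¹` of the `i`-th denominator factor, the sum reduces to a shorter sum
of the same shape. -/
lemma rahmanSum_add_of_pole {Q a E : R} (g h s : R) {i : ℕ}
    (hE : E * Q ^ i = 1 + a * Q ^ (2 * i + 1)) (m : ℕ) :
    rahmanSum Q a E g h s (i + 1 + m) =
      Q ^ (i + 1) * (∏ j ∈ range (i + 1), rahmanNum Q a E g h s j) *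
        rahmanSum Q (a * Q ^ (3 * i + 3)) (a * Q ^ (2 * i + 2) + Q ^ (i + 2))
          (g * Q ^ (2 * i + 2)) (h * Q ^ (i + 1)) (s * Q ^ (i + 1)) m := by
  have hE1 (j : ℕ) : E * Q ^ (i + 1 + j) = (1 + a * Q ^ (2 * i + 1)) * Q ^ (1 + j) := by
    rw [← hE]; ring
  have hE2 (j : ℕ) :
      E * Q ^ (2 * (i + 1 + j)) = (1 + a * Q ^ (2 * i + 1)) * Q ^ (i + 2 + 2 * j) := by
    rw [← hE]; ring
  have hnum (j : ℕ) : rahmanNum Q a E g h s (i + 1 + j) =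
      rahmanNum Q (a * Q ^ (3 * i + 3)) (a * Q ^ (2 * i + 2) + Q ^ (i + 2))
          (g * Q ^ (2 * i + 2)) (h * Q ^ (i + 1)) (s * Q ^ (i + 1)) j := by
    simp only [rahmanNum, hE2]; ring
  have hden (j : ℕ) : rahmanDen Q a E g h s (i + 1 + j) =
      rahmanDen Q (a * Q ^ (3 * i + 3)) (a * Q ^ (2 * i + 2) + Q ^ (i + 2))
          (g * Q ^ (2 * i + 2)) (h * Q ^ (i + 1)) (s * Q ^ (i + 1)) j := by
    simp only [rahmanDen, hE1]; ring
  induction m with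
  | zero =>
    have h0 : rahmanDen Q a E g h s i = 0 := by
      rw [rahmanDen, hE]; ring
    rw [add_zero, rahmanSum_succ, h0, rahmanSum_zero]
    ring
  | succ m ih =>
    rw [← add_assoc, rahmanSum_succ, ih, rahmanSum_succ, hden, add_assoc (i + 1) m 1,
      prod_range_add _ (i + 1) (m + 1)]
    simp only [hnum]
    ring

lemma rahmanSum_eq_zero_of_even_pole {Q a E : R} (g h s : R) {i K : ℕ} (hi : Even i) (hiK : i < K)
    (hE : E * Q ^ i = 1 + a * Q ^ (2 * i + 1)) : rahmanSum Q a E g h s K = 0 := by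
  obtain ⟨r, rfl⟩ := hi
  have hnum : rahmanNum Q a E g h s r = 0 := by
    rw [rahmanNum, two_mul r, hE]; ring
  have hden : rahmanDen Q a E g h s (r + r) = 0 := by
    rw [rahmanDen, hE]; ring
  rw [rahmanSum_of_rahmanNum_eq_zero hnum (by omega : r ≤ K),
    prod_eq_zero (mem_Ico.2 ⟨by omega, hiK⟩) hden, mul_zero]

/-- Gasper's indefinite bibasic summation, the case `e = bcQ` of Rahman's sum. -/
lemma rahmanSum_gasper (Q g h s : R) (K : ℕ) :
    rahmanSum Q (h * g) (g * Q + h) g h s K =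
      (1 - h * g) * ∏ j ∈ range K, ((1 - h * Q ^ j) * (1 - g * Q ^ (2 * j + 1)) *
        (1 - h * g * Q ^ (2 * j + 2)) * (1 - h * Q ^ (2 * j + 2)) *
        (1 - s * Q ^ (j + 1) + g * Q ^ (2 * j + 2))) := by
  have hprod (K : ℕ) : ∏ j ∈ range (K + 1), rahmanNum Q (h * g) (g * Q + h) g h s j =
      (1 - h * g) * (∏ j ∈ range K, ((1 - h * Q ^ j) * (1 - g * Q ^ (2 * j + 1)) *
        (1 - h * g * Q ^ (2 * j + 2)) * (1 - h * Q ^ (2 * j + 2)) *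
        (1 - s * Q ^ (j + 1) + g * Q ^ (2 * j + 2)))) *
      ((1 - g * Q ^ (2 * K + 1)) * (1 - h * Q ^ K) * (1 - h * Q ^ (K + 1)) * (1 - s + g)) := by
    induction K with
    | zero => simp [rahmanNum]; ring
    | succ K ih =>
      rw [prod_range_succ, ih, prod_range_succ, rahmanNum]
      ring
  induction K with
  | zero => simp [rahmanSum_zero]
  | succ K ih =>
    rw [rahmanSum_succ, ih, hprod, prod_range_succ, rahmanDen]
    ring

end CommRing

section Field

variable {F : Type*} [Field F]

lemma natDegree_rahmanSum_le (Q a g h s : F) (K : ℕ) :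
    (rahmanSum (Polynomial.C Q) (Polynomial.C a) Polynomial.X (Polynomial.C g) (Polynomial.C h)
      (Polynomial.C s) K).natDegree ≤ K := by
  have hnum (j : ℕ) : (rahmanNum (Polynomial.C Q) (Polynomial.C a) Polynomial.X (Polynomial.C g)
      (Polynomial.C h) (Polynomial.C s) j).natDegree ≤ 1 := by
    unfold rahmanNum
    compute_degree
  have hden (j : ℕ) : (rahmanDen (Polynomial.C Q) (Polynomial.C a) Polynomial.X (Polynomial.C g)
      (Polynomial.C h) (Polynomial.C s) j).natDegree ≤ 1 := by
    unfold rahmanDen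
    compute_degree
  induction K with
  | zero => rw [rahmanSum_zero]; compute_degree
  | succ K ih =>
    rw [rahmanSum_succ]
    refine Polynomial.natDegree_add_le_of_degree_le
      (Polynomial.natDegree_mul_le_of_le ih (hden K)) ?_
    rw [← zero_add (K + 1)]
    refine Polynomial.natDegree_mul_le_of_le (by compute_degree) ?_
    refine (Polynomial.natDegree_prod_le _ _).trans ((sum_le_sum fun j _ => hnum j).trans ?_)
    simp

/-- Rahman's sum vanishes identically in `E` as soon as it vanishes at the odd poles and at Gasper's
point: together with the even poles these are more points than its degree in `E`. -/
lemma rahmanSum_eq_zero_of_odd_poles {Q g h s : F} {K : ℕ} (hQ0 : Q ≠ 0)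
    (hQ : ∀ m : ℕ, 0 < m → Q ^ m ≠ 1)
    (ha : ∀ i j : ℕ, i < j → j < K → h * g * Q ^ (i + j + 1) ≠ 1)
    (hg : ∀ j : ℕ, g * Q ^ (j + 1) ≠ 1) (hh : ∀ j < K, h * Q ^ j ≠ 1)
    (hgasper : rahmanSum Q (h * g) (g * Q + h) g h s K = 0)
    (hodd : ∀ i < K, Odd i → ∀ E : F, E * Q ^ i = 1 + h * g * Q ^ (2 * i + 1) →
      rahmanSum Q (h * g) E g h s K = 0) (E : F) :
    rahmanSum Q (h * g) E g h s K = 0 := by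
  classical
  set P : Polynomial F := rahmanSum (Polynomial.C Q) (Polynomial.C (h * g)) Polynomial.X
    (Polynomial.C g) (Polynomial.C h) (Polynomial.C s) K with hP
  have heval (x : F) : P.eval x = rahmanSum Q (h * g) x g h s K := by
    rw [hP, ← Polynomial.coe_evalRingHom, map_rahmanSum]
    simp
  let pole : ℕ → F := fun i => (1 + h * g * Q ^ (2 * i + 1)) / Q ^ i
  have hpole (i : ℕ) : pole i * Q ^ i = 1 + h * g * Q ^ (2 * i + 1) :=
    div_mul_cancel₀ _ (pow_ne_zero _ hQ0)
  have hlt : ∀ i j : ℕ, i < j → j < K → pole i ≠ pole j := by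
    intro i j hij hj heq
    obtain ⟨m, rfl⟩ := Nat.exists_eq_add_of_lt hij
    have h1 := hpole i
    have h2 := hpole (i + m + 1)
    rw [← heq] at h2
    have h3 : (1 - Q ^ (m + 1)) * (1 - h * g * Q ^ (i + (i + m + 1) + 1)) = 0 := by
      linear_combination Q ^ (m + 1) * h1 - h2
    rcases mul_eq_zero.1 h3 with h4 | h4
    · exact hQ (m + 1) (Nat.succ_pos m) (sub_eq_zero.1 h4).symm
    · exact ha _ _ hij hj (sub_eq_zero.1 h4).symm
  have hinj : Set.InjOn pole (range K : Set ℕ) := by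
    intro i hi j hj heq
    simp only [coe_range, Set.mem_Iio] at hi hj
    rcases lt_trichotomy i j with hij | hij | hij
    · exact absurd heq (hlt i j hij hj)
    · exact hij
    · exact absurd heq.symm (hlt j i hij hi)
  have hnot : g * Q + h ∉ (range K).image pole := by
    simp only [mem_image, mem_range, not_exists, not_and]
    intro i hi heq
    have h1 := hpole i
    rw [heq] at h1
    have h2 : (1 - g * Q ^ (i + 1)) * (1 - h * Q ^ i) = 0 := by
      linear_combination -h1
    rcases mul_eq_zero.1 h2 with h4 | h4
    · exact hg _ (sub_eq_zero.1 h4).symm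
    · exact hh _ hi (sub_eq_zero.1 h4).symm
  have hzero : P = 0 := by
    refine Polynomial.eq_zero_of_natDegree_lt_card_of_eval_eq_zero' P
      (insert (g * Q + h) ((range K).image pole)) ?_ ?_
    · intro x hx
      rw [heval]
      rcases mem_insert.1 hx with rfl | hx
      · exact hgasper
      · obtain ⟨i, hi, rfl⟩ := mem_image.1 hx
        rcases Nat.even_or_odd i with hev | hod
        · exact rahmanSum_eq_zero_of_even_pole g h s hev (mem_range.1 hi) (hpole i)
        · exact hodd i (mem_range.1 hi) hod _ (hpole i)
    · rw [card_insert_of_notMem hnot, card_image_of_injOn hinj, card_range]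
      exact Nat.lt_succ_of_le (natDegree_rahmanSum_le _ _ _ _ _ _)
  rw [← heval, hzero, Polynomial.eval_zero]

/-- Rahman's sum with `b = Q⁻ᴺ` and `N` odd vanishes. -/
theorem rahmanSum_eq_zero_of_odd {Q : F} (hQ0 : Q ≠ 0) (hQ : ∀ m : ℕ, 0 < m → Q ^ m ≠ 1)
    {N : ℕ} (hN : Odd N) {g h s : F} (ha : ∀ m : ℕ, h * g * Q ^ m ≠ 1)
    (hg : ∀ j : ℕ, g * Q ^ (j + 1) ≠ 1) (hh : ∀ j < N, h * Q ^ j ≠ 1)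
    (hs : s * Q ^ N = 1 + g * Q ^ (2 * N)) (E : F) :
    rahmanSum Q (h * g) E g h s N = 0 := by
  induction N using Nat.strong_induction_on generalizing g h s E with
  | _ N ih =>
  refine rahmanSum_eq_zero_of_odd_poles hQ0 hQ (fun i j _ _ => ha _) hg hh ?_ ?_ E
  · obtain ⟨r, rfl⟩ := hN
    rw [rahmanSum_gasper, prod_range_succ, hs]
    ring
  · intro i hi hiodd E hE
    obtain ⟨m, rfl⟩ : ∃ m, N = i + 1 + m := ⟨N - (i + 1), by omega⟩
    rw [rahmanSum_add_of_pole g h s hE]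
    have key := ih m (by omega) (by
        rcases Nat.even_or_odd m with hm | hm
        · exact absurd hN (Nat.not_odd_iff_even.2 (hiodd.add_one.add hm))
        · exact hm)
      (g := g * Q ^ (2 * i + 2)) (h := h * Q ^ (i + 1)) (s := s * Q ^ (i + 1))
      (fun k => by convert ha (3 * i + 3 + k) using 1; ring)
      (fun j => by convert hg (2 * i + 2 + j) using 1; ring)
      (fun j hj => by convert hh (i + 1 + j) (by omega) using 1; ring)
      (by linear_combination hs) (h * g * Q ^ (2 * i + 2) + Q ^ (i + 2))
    rw [show h * g * Q ^ (3 * i + 3) = h * Q ^ (i + 1) * (g * Q ^ (2 * i + 2)) by ring, key,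
      mul_zero]

/-- Rahman's sum with `a = Q⁻²ᴹ` vanishes. -/
theorem rahmanSum_eq_zero_of_terminating {Q : F} (hQ0 : Q ≠ 0) (hQ : ∀ m : ℕ, 0 < m → Q ^ m ≠ 1)
    {M : ℕ} {g h s : F} (ha : h * g * Q ^ (2 * M) = 1)
    (hg : ∀ j : ℕ, g * Q ^ (j + 1) ≠ 1) (hh : ∀ j < M, h * Q ^ j ≠ 1) (E : F) :
    rahmanSum Q (h * g) E g h s M = 0 := by
  induction M using Nat.strong_induction_on generalizing g h s E with
  | _ M ih =>
  refine rahmanSum_eq_zero_of_odd_poles hQ0 hQ ?_ hg hh ?_ ?_ E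
  · intro i j hij hj heq
    refine hQ (2 * M - (i + j + 1)) (by omega) ?_
    rw [← one_mul (Q ^ _), ← heq, mul_assoc, ← pow_add,
      show i + j + 1 + (2 * M - (i + j + 1)) = 2 * M by omega, ha, heq]
  · rw [rahmanSum_gasper]
    rcases M with _ | M
    · rw [mul_zero, pow_zero, mul_one] at ha
      simp [ha]
    · rw [prod_range_succ, show 2 * M + 2 = 2 * (M + 1) by ring, ha]
      ring
  · intro i hi hiodd E hE
    obtain ⟨m, rfl⟩ : ∃ m, M = i + 1 + m := ⟨M - (i + 1), by omega⟩
    rw [rahmanSum_add_of_pole g h s hE]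
    obtain ⟨r, rfl⟩ := hiodd
    by_cases hr : m < r + 1
    · have hzero : rahmanNum Q (h * g) E g h s (r + 1 + m) = 0 := by
        have h1 : 1 - E * Q ^ (2 * (r + 1 + m)) + h * g * Q ^ (4 * (r + 1 + m) + 1) = 0 := by
          linear_combination (-Q ^ (2 * m + 1)) * hE + (Q ^ (2 * m + 1) - 1) * ha
        rw [rahmanNum, h1]
        ring
      rw [prod_eq_zero (mem_range.2 (by omega)) hzero]
      ring
    · obtain ⟨l, rfl⟩ : ∃ l, m = l + (r + 1) := ⟨m - (r + 1), by omega⟩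
      have ha' : h * Q ^ (2 * r + 1 + 1) * (g * Q ^ (2 * (2 * r + 1) + 2)) * Q ^ (2 * l) = 1 := by
        rw [← ha]; ring
      have key := ih l (by omega) (s := s * Q ^ (2 * r + 1 + 1)) ha'
        (fun j => by convert hg (2 * (2 * r + 1) + 2 + j) using 1; ring)
        (fun j hj => by convert hh (2 * r + 1 + 1 + j) (by omega) using 1; ring)
        (h * g * Q ^ (2 * (2 * r + 1) + 2) + Q ^ (2 * r + 1 + 2))
      rw [show h * g * Q ^ (3 * (2 * r + 1) + 3) =
        h * Q ^ (2 * r + 1 + 1) * (g * Q ^ (2 * (2 * r + 1) + 2)) by ring,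
        rahmanSum_of_rahmanNum_eq_zero (N := l) (by rw [rahmanNum, ha']; ring) (by omega), key]
      ring

end Field

section Specialization

variable {F : Type*} [Field F]

lemma prod_rahmanNum_eq_qPoch {q e : F} (hq : q ≠ 0) (he : e ≠ 0) (Q : F) (k : ℕ) :
    ∏ j ∈ range k, rahmanNum Q q⁻¹ (e + q⁻¹ * Q / e) (q ^ 2) (q⁻¹ ^ 3) (q * 2) j =
      qPoch q⁻¹ (Q ^ 2) k * qPoch e (Q ^ 2) k * qPoch (q⁻¹ * Q / e) (Q ^ 2) k *
        (qPoch q Q k * qPoch q Q k * qPoch (q⁻¹ ^ 3 * Q) Q k) := by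
  simp only [qPoch, ← prod_mul_distrib]
  refine prod_congr rfl fun j _ => ?_
  have h1 : 1 - (e + q⁻¹ * Q / e) * Q ^ (2 * j) + q⁻¹ * Q ^ (4 * j + 1) =
      (1 - e * (Q ^ 2) ^ j) * (1 - q⁻¹ * Q / e * (Q ^ 2) ^ j) := by
    field_simp; ring
  rw [rahmanNum, h1]
  ring

lemma rahmanDen_eq {q e : F} (hq : q ≠ 0) (he : e ≠ 0) (Q : F) (j : ℕ) :
    rahmanDen Q q⁻¹ (e + q⁻¹ * Q / e) (q ^ 2) (q⁻¹ ^ 3) (q * 2) j =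
      (1 - Q * Q ^ j) * (1 - e * Q ^ j) * (1 - q⁻¹ * Q / e * Q ^ j) *
        ((1 - q⁻¹ ^ 2 * Q ^ 2 * (Q ^ 2) ^ j) * (1 - q⁻¹ ^ 2 * Q ^ 2 * (Q ^ 2) ^ j) *
          (1 - q ^ 2 * Q * (Q ^ 2) ^ j)) := by
  have h1 : 1 - (e + q⁻¹ * Q / e) * Q ^ j + q⁻¹ * Q ^ (2 * j + 1) =
      (1 - e * Q ^ j) * (1 - q⁻¹ * Q / e * Q ^ j) := by
    field_simp; ring
  have h2 : 1 - q⁻¹ ^ 3 * (q * 2) * Q ^ (2 * j + 2) + q⁻¹ ^ 3 * q⁻¹ * Q ^ (4 * j + 4) =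
      (1 - q⁻¹ ^ 2 * Q ^ 2 * (Q ^ 2) ^ j) * (1 - q⁻¹ ^ 2 * Q ^ 2 * (Q ^ 2) ^ j) := by
    field_simp; ring
  rw [rahmanDen, h1, h2]
  ring

lemma prod_rahmanDen_eq_qPoch {q e : F} (hq : q ≠ 0) (he : e ≠ 0) (Q : F) (k : ℕ) :
    ∏ j ∈ range k, rahmanDen Q q⁻¹ (e + q⁻¹ * Q / e) (q ^ 2) (q⁻¹ ^ 3) (q * 2) j =
      qPoch Q Q k * qPoch e Q k * qPoch (q⁻¹ * Q / e) Q k *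
        (qPoch (q⁻¹ ^ 2 * Q ^ 2) (Q ^ 2) k * qPoch (q⁻¹ ^ 2 * Q ^ 2) (Q ^ 2) k *
          qPoch (q ^ 2 * Q) (Q ^ 2) k) := by
  simp only [qPoch, ← prod_mul_distrib, rahmanDen_eq hq he]

end Specialization

lemma Phi2_dvd_X_pow_sub_one (n : ℕ) : Phi2 n ∣ MvPolynomial.X 0 ^ n - 1 := by
  have h := map_dvd (Polynomial.aeval (MvPolynomial.X 0 : R2))
    (Polynomial.cyclotomic.dvd_X_pow_sub_one n ℚ)
  simpa [Phi2] using h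

lemma Phi2_ne_zero (n : ℕ) : Phi2 n ≠ 0 := by
  intro h
  have h1 := congrArg (MvPolynomial.aeval (fun _ : Fin 2 => (Polynomial.X : Polynomial ℚ))) h
  rw [Phi2, ← Polynomial.aeval_algHom_apply, map_zero, MvPolynomial.aeval_X,
    Polynomial.aeval_X_left_apply] at h1
  exact Polynomial.cyclotomic_ne_zero n ℚ h1

lemma X_pow_sub_one_ne_zero {n : ℕ} (hn : 0 < n) : (MvPolynomial.X 0 ^ n - 1 : R2) ≠ 0 := by
  intro h
  have h1 := congrArg (MvPolynomial.aeval (fun _ : Fin 2 => (0 : ℚ))) h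
  simp [hn.ne'] at h1

lemma isUnit_of_dvd_one_sub_X_pow {n m : ℕ} (hm0 : 0 < m) (hm : ¬ n ∣ m) {p : R2} (hp : p ∣ Phi2 n)
    (hpm : p ∣ 1 - MvPolynomial.X 0 ^ m) : IsUnit p := by
  have hcop : IsCoprime (Polynomial.cyclotomic n ℚ) (Polynomial.X ^ m - 1) := by
    rw [← Polynomial.prod_cyclotomic_eq_X_pow_sub_one hm0]
    refine IsCoprime.prod_right fun i hi => Polynomial.cyclotomic.isCoprime_rat ?_
    rintro rfl
    exact hm (Nat.dvd_of_mem_divisors hi)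
  have h := hcop.map (Polynomial.aeval (MvPolynomial.X 0 : R2)).toRingHom
  refine h.isUnit_of_dvd' hp ?_
  rw [← dvd_neg] at hpm
  simpa using hpm

/-- A divisor of `Φ_n(q)` does not involve `e`, so it divides every specialization in `e` of any
of its multiples. -/
lemma dvd_specialize_of_dvd_Phi2 {n : ℕ} (hn : 0 < n) {p f : R2} (hp : p ∣ Phi2 n) (hpf : p ∣ f)
    (y : R2) : p ∣ MvPolynomial.aeval ![MvPolynomial.X 0, y] f := by
  have hne := X_pow_sub_one_ne_zero hn
  obtain ⟨r, hr⟩ := hp.trans (Phi2_dvd_X_pow_sub_one n)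
  have hdeg : MvPolynomial.degreeOf 1 p = 0 := by
    have h1 : MvPolynomial.degreeOf 1 (MvPolynomial.X 0 ^ n - 1 : R2) = 0 := by
      rw [← Nat.le_zero]
      refine (MvPolynomial.degreeOf_sub_le _ _ _).trans ?_
      simp only [MvPolynomial.degreeOf_one, Nat.le_zero, max_eq_zero]
      refine ⟨?_, trivial⟩
      rw [← Nat.le_zero]
      refine (MvPolynomial.degreeOf_pow_le _ _ _).trans ?_
      rw [MvPolynomial.degreeOf_X_of_ne (by decide)]
      simp
    rw [hr] at h1 hne
    rw [MvPolynomial.degreeOf_mul_eq (left_ne_zero_of_mul hne) (right_ne_zero_of_mul hne)] at h1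
    omega
  have hvars : (1 : Fin 2) ∉ p.vars := by
    rwa [MvPolynomial.mem_vars_iff_degreeOf_ne_zero, not_not]
  have hfix : MvPolynomial.aeval ![MvPolynomial.X 0, y] p = p := by
    conv_rhs => rw [← MvPolynomial.aeval_X_left_apply p]
    refine MvPolynomial.eval₂Hom_congr' rfl ?_ rfl
    intro i hi _
    fin_cases i
    · rfl
    · exact absurd hi hvars
  have h := map_dvd (MvPolynomial.aeval ![MvPolynomial.X 0, y]) hpf
  rwa [hfix] at h

/-- The rational functions whose denominator is prime to `Φ_n(q)`. -/
def cycloRegular (n : ℕ) : Subring K2 where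
  carrier := {x | ∃ f g : R2, g ≠ 0 ∧ (∀ p : R2, Prime p → p ∣ g → ¬ p ∣ Phi2 n) ∧
    x * algebraMap R2 K2 g = algebraMap R2 K2 f}
  mul_mem' := by
    rintro x y ⟨f, g, hg, hp, hx⟩ ⟨f', g', hg', hp', hy⟩
    refine ⟨f * f', g * g', mul_ne_zero hg hg',
      fun p hpp hd => (hpp.dvd_or_dvd hd).elim (hp p hpp) (hp' p hpp), ?_⟩
    rw [map_mul, map_mul, ← hx, ← hy]
    ring
  one_mem' := ⟨1, 1, one_ne_zero, fun p hpp hd => absurd (isUnit_of_dvd_one hd) hpp.not_isUnit,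
    by simp⟩
  add_mem' := by
    rintro x y ⟨f, g, hg, hp, hx⟩ ⟨f', g', hg', hp', hy⟩
    refine ⟨f * g' + f' * g, g * g', mul_ne_zero hg hg',
      fun p hpp hd => (hpp.dvd_or_dvd hd).elim (hp p hpp) (hp' p hpp), ?_⟩
    rw [map_mul, map_add, map_mul, map_mul, ← hx, ← hy]
    ring
  zero_mem' := ⟨0, 1, one_ne_zero, fun p hpp hd => absurd (isUnit_of_dvd_one hd) hpp.not_isUnit,
    by simp⟩
  neg_mem' := by
    rintro x ⟨f, g, hg, hp, hx⟩
    exact ⟨-f, g, hg, hp, by rw [map_neg, ← hx]; ring⟩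

lemma algebraMap_mem_cycloRegular (n : ℕ) (f : R2) : algebraMap R2 K2 f ∈ cycloRegular n :=
  ⟨f, 1, one_ne_zero, fun _ hpp hd => absurd (isUnit_of_dvd_one hd) hpp.not_isUnit, by simp⟩

/-- The rational functions that are units modulo `Φ_n(q)`. -/
def cycloUnits (n : ℕ) : Submonoid K2 where
  carrier := {x | x ≠ 0 ∧ x ∈ cycloRegular n ∧ x⁻¹ ∈ cycloRegular n}
  mul_mem' := by
    rintro x y ⟨hx, hx1, hx2⟩ ⟨hy, hy1, hy2⟩
    exact ⟨mul_ne_zero hx hy, mul_mem hx1 hy1, by rw [mul_inv]; exact mul_mem hx2 hy2⟩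
  one_mem' := ⟨one_ne_zero, one_mem _, by rw [inv_one]; exact one_mem _⟩

lemma inv_mem_cycloUnits {n : ℕ} {x : K2} (hx : x ∈ cycloUnits n) : x⁻¹ ∈ cycloUnits n :=
  ⟨inv_ne_zero hx.1, hx.2.2, by rw [inv_inv]; exact hx.2.1⟩

lemma algebraMap_mem_cycloUnits {n : ℕ} {g : R2}
    (h : ∀ p : R2, p ∣ Phi2 n → p ∣ g → IsUnit p) (hg : g ≠ 0) :
    algebraMap R2 K2 g ∈ cycloUnits n := by
  have hne : algebraMap R2 K2 g ≠ 0 := by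
    rwa [Ne, FaithfulSMul.algebraMap_eq_zero_iff]
  refine ⟨hne, algebraMap_mem_cycloRegular n g, 1, g, hg, fun p hpp hd hd' => ?_, ?_⟩
  · exact hpp.not_isUnit (h p hd' hd)
  · rw [inv_mul_cancel₀ hne, map_one]

lemma algebraMap_mem_cycloUnits_of_specialize {n : ℕ} (hn : 0 < n) {g : R2} (y : R2)
    (hy : MvPolynomial.aeval ![MvPolynomial.X 0, y] g = 1) :
    algebraMap R2 K2 g ∈ cycloUnits n := by
  refine algebraMap_mem_cycloUnits (fun p hp hd => ?_) ?_
  · have h := dvd_specialize_of_dvd_Phi2 hn hp hd y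
    rw [hy] at h
    exact isUnit_of_dvd_one h
  · rintro rfl
    simp at hy

lemma qv_mem_cycloUnits {n : ℕ} (hn : 0 < n) : qv ∈ cycloUnits n := by
  refine algebraMap_mem_cycloUnits (fun p hp hd => ?_) (MvPolynomial.X_ne_zero 0)
  have h := (dvd_sub_right (dvd_pow hd hn.ne')).1 (hp.trans (Phi2_dvd_X_pow_sub_one n))
  exact isUnit_of_dvd_one h

lemma one_sub_qv_pow_mem_cycloUnits {n m : ℕ} (hm : ¬ n ∣ m) : 1 - qv ^ m ∈ cycloUnits n := by
  have hm0 : 0 < m := Nat.pos_of_ne_zero fun h => hm (h ▸ dvd_zero n)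
  have h : algebraMap R2 K2 (1 - MvPolynomial.X 0 ^ m) = 1 - qv ^ m := by simp [qv]
  rw [← h]
  refine algebraMap_mem_cycloUnits (fun p hp hd => isUnit_of_dvd_one_sub_X_pow hm0 hm hp hd) ?_
  rw [← neg_ne_zero, neg_sub]
  exact X_pow_sub_one_ne_zero hm0

lemma ev_mem_cycloUnits {n : ℕ} (hn : 0 < n) : ev ∈ cycloUnits n :=
  algebraMap_mem_cycloUnits_of_specialize hn 1 (by simp)

lemma one_sub_ev_mul_qv_pow_mem_cycloUnits {n : ℕ} (hn : 0 < n) (m : ℕ) :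
    1 - ev * qv ^ m ∈ cycloUnits n := by
  have h : algebraMap R2 K2 (1 - MvPolynomial.X 1 * MvPolynomial.X 0 ^ m) = 1 - ev * qv ^ m := by
    simp [qv, ev]
  rw [← h]
  exact algebraMap_mem_cycloUnits_of_specialize hn 0 (by simp)

lemma one_sub_qv_pow_div_ev_mem_cycloUnits {n : ℕ} (hn : 0 < n) (m : ℕ) :
    1 - qv ^ m / ev ∈ cycloUnits n := by
  have h : algebraMap R2 K2 (MvPolynomial.X 1 - MvPolynomial.X 0 ^ m) = ev - qv ^ m := by
    simp [qv, ev]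
  have he := ev_mem_cycloUnits hn
  have h1 : 1 - qv ^ m / ev = (ev - qv ^ m) * ev⁻¹ := by
    rw [sub_mul, mul_inv_cancel₀ he.1, div_eq_mul_inv]
  rw [h1, ← h]
  exact mul_mem (algebraMap_mem_cycloUnits_of_specialize hn (1 + MvPolynomial.X 0 ^ m) (by simp))
    (inv_mem_cycloUnits he)

lemma qv_ne_zero : qv ≠ 0 := (qv_mem_cycloUnits one_pos).1

lemma ev_ne_zero : ev ≠ 0 := (ev_mem_cycloUnits one_pos).1

lemma qv_zpow_ne_one {m : ℤ} (hm : m ≠ 0) : qv ^ m ≠ 1 := by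
  have hnat (k : ℕ) (hk : 0 < k) : qv ^ k ≠ 1 := fun h =>
    (one_sub_qv_pow_mem_cycloUnits (n := k + 1)
      fun hd => absurd (Nat.le_of_dvd hk hd) (by omega)).1 (sub_eq_zero.2 h.symm)
  obtain ⟨k, rfl | rfl⟩ := m.eq_nat_or_neg
  · rw [zpow_natCast]
    exact hnat k (by omega)
  · rw [zpow_neg, zpow_natCast, Ne, inv_eq_one]
    exact hnat k (by omega)

/-- If `P ≡ 0 (mod Φ)` coefficientwise and `P` vanishes at a point congruent to `x` modulo `Φ²`, then `P(x)` is divisible by `Φ³`. -/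
lemma pow_three_dvd_eval {A : Type*} [CommRing A] [IsDomain A] {Φ x t : A} (hΦ : Φ ≠ 0)
    {P : Polynomial A} (hP : P.map (Ideal.Quotient.mk (Ideal.span {Φ})) = 0) (ht : P.eval t = 0)
    (hx : Φ ^ 2 ∣ x - t) : Φ ^ 3 ∣ P.eval x := by
  have hdvd : Polynomial.C Φ ∣ P := by
    rw [Polynomial.C_dvd_iff_dvd_coeff]
    intro i
    have h := congrArg (fun p => Polynomial.coeff p i) hP
    rw [Polynomial.coeff_map, Polynomial.coeff_zero, Ideal.Quotient.eq_zero_iff_mem,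
      Ideal.mem_span_singleton] at h
    exact h
  obtain ⟨T, rfl⟩ := hdvd
  rw [Polynomial.eval_mul, Polynomial.eval_C] at ht ⊢
  have hT : T.eval t = 0 := (mul_eq_zero.1 ht).resolve_left hΦ
  have h := hx.trans (Polynomial.sub_dvd_eval_sub x t T)
  rw [hT, sub_zero] at h
  rw [pow_succ' Φ 2]
  exact mul_dvd_mul_left Φ h

/-- The cubic divisibility of the cleared sum: it vanishes modulo `Φ_n` identically in `s`, and it
vanishes exactly at `s = q¹⁺ⁿ + q¹⁻ⁿ`. -/
lemma rahmanSum_mem_Phi2_pow_three {d n N L M : ℕ} (hd : 2 ≤ d) (hdeven : Even d)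
    (hN : n = d * N + 1) (hNodd : Odd N) (hNM : N ≤ M) (hLM : L ≤ M)
    (hL : 2 * d * L = n * (d - 1) + 1) :
    ∃ y ∈ cycloRegular n,
      rahmanSum (qv ^ d) qv⁻¹ (ev + qv⁻¹ * qv ^ d / ev) (qv ^ 2) (qv⁻¹ ^ 3) (qv * 2) M =
        algebraMap R2 K2 (Phi2 n) ^ 3 * y := by
  have hn : 0 < n := by omega
  have hq0 := qv_ne_zero
  let A := cycloRegular n
  let q : A := ⟨qv, (qv_mem_cycloUnits hn).2.1⟩
  let q' : A := ⟨qv⁻¹, (qv_mem_cycloUnits hn).2.2⟩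
  let e : A := ⟨ev, (ev_mem_cycloUnits hn).2.1⟩
  let e' : A := ⟨ev⁻¹, (ev_mem_cycloUnits hn).2.2⟩
  let Φ : A := ⟨algebraMap R2 K2 (Phi2 n), algebraMap_mem_cycloRegular n _⟩
  have hqq : q * q' = 1 := Subtype.ext (mul_inv_cancel₀ hq0)
  have hΦ0 : Φ ≠ 0 := by
    intro h
    have h1 : algebraMap R2 K2 (Phi2 n) = 0 := congrArg Subtype.val h
    rw [FaithfulSMul.algebraMap_eq_zero_iff] at h1
    exact Phi2_ne_zero n h1
  have hΦq : Φ ∣ q ^ n - 1 := by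
    obtain ⟨r, hr⟩ := Phi2_dvd_X_pow_sub_one n
    refine ⟨⟨algebraMap R2 K2 r, algebraMap_mem_cycloRegular n _⟩, Subtype.ext ?_⟩
    have h := congrArg (algebraMap R2 K2) hr
    simpa [qv, q, Φ] using h
  let poly (a : A) : Polynomial A := rahmanSum (Polynomial.C (q ^ d)) (Polynomial.C a)
    (Polynomial.C (e + a * q ^ d * e')) (Polynomial.C (q ^ 2)) (Polynomial.C (a * q' ^ 2))
    (Polynomial.C q * Polynomial.X) M
  have heval (a x : A) : (((poly a).eval x : A) : K2) =
      rahmanSum (qv ^ d) a (ev + a * qv ^ d / ev) (qv ^ 2) (a * qv⁻¹ ^ 2) (qv * x) M := by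
    change A.subtype (Polynomial.evalRingHom x (poly a)) = _
    rw [map_rahmanSum, map_rahmanSum]
    simp [q, q', e, e', div_eq_mul_inv]
  have hQ (m : ℕ) (hm : 0 < m) : (qv ^ d) ^ m ≠ 1 := by
    rw [← pow_mul, ← zpow_natCast]
    exact qv_zpow_ne_one (by positivity)
  have hg (j : ℕ) : qv ^ 2 * (qv ^ d) ^ (j + 1) ≠ 1 := by
    rw [← pow_mul, ← pow_add, ← zpow_natCast]
    exact qv_zpow_ne_one (by positivity)
  have hterm : poly (q' ^ (2 * d * L)) = 0 := by
    have hinf : ∀ x : A, (poly (q' ^ (2 * d * L))).eval x = 0 := by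
      intro x
      refine Subtype.ext ?_
      rw [heval]
      simp only [SubmonoidClass.coe_pow, ZeroMemClass.coe_zero, q']
      set a : K2 := qv⁻¹ ^ (2 * d * L) with ha
      have haQ : a * (qv ^ d) ^ (2 * L) = 1 := by
        rw [ha, ← pow_mul, show d * (2 * L) = 2 * d * L by ring, ← mul_pow,
          inv_mul_cancel₀ hq0, one_pow]
      have hag : a = a * qv⁻¹ ^ 2 * qv ^ 2 := by
        rw [mul_assoc, ← mul_pow, inv_mul_cancel₀ hq0, one_pow, mul_one]
      have hnum (E h s : K2) : rahmanNum (qv ^ d) a E (qv ^ 2) h s L = 0 := by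
        rw [rahmanNum, haQ]; ring
      rw [rahmanSum_of_rahmanNum_eq_zero (hnum _ _ _) hLM]
      refine mul_eq_zero_of_left ?_ _
      generalize ev + a * qv ^ d / ev = E
      have key := rahmanSum_eq_zero_of_terminating (s := qv * (x : K2)) (pow_ne_zero d hq0) hQ
        (M := L) (g := qv ^ 2) (h := a * qv⁻¹ ^ 2) (by rw [← hag, haQ]) hg ?_ E
      · rwa [← hag] at key
      · intro j hj
        have h1 : a * qv⁻¹ ^ 2 * (qv ^ d) ^ j = qv ^ ((d * j : ℤ) - (2 * d * L + 2)) := by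
          rw [zpow_sub₀ hq0, ha]
          norm_cast
          rw [pow_add, pow_mul qv d j, inv_pow, inv_pow]
          field_simp
        rw [h1]
        refine qv_zpow_ne_one ?_
        have h2 : d * j ≤ d * L := Nat.mul_le_mul_left d hj.le
        have h3 : ((d * j : ℕ) : ℤ) ≤ (d * L : ℕ) := by exact_mod_cast h2
        push_cast at h3
        nlinarith [mul_nonneg (Int.natCast_nonneg d) (Int.natCast_nonneg L)]
    exact Polynomial.funext fun x => by rw [hinf, Polynomial.eval_zero]
  have hmk : Ideal.Quotient.mk (Ideal.span {Φ}) q' =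
      Ideal.Quotient.mk (Ideal.span {Φ}) (q' ^ (2 * d * L)) := by
    have hqn : Ideal.Quotient.mk (Ideal.span {Φ}) q ^ n = 1 := by
      rw [← map_pow, ← map_one (Ideal.Quotient.mk (Ideal.span {Φ})), Ideal.Quotient.eq,
        Ideal.mem_span_singleton]
      exact hΦq
    have hq'n : Ideal.Quotient.mk (Ideal.span {Φ}) q' ^ n = 1 := by
      rw [← one_mul (_ ^ n), ← hqn, ← mul_pow, ← map_mul, hqq, map_one, one_pow, hqn]
    rw [hL, map_pow, pow_succ, pow_mul, hq'n, one_pow, one_mul]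
  have hmap : (poly q').map (Ideal.Quotient.mk (Ideal.span {Φ})) = 0 := by
    have hcongr : Polynomial.mapRingHom (Ideal.Quotient.mk (Ideal.span {Φ})) (poly q') =
        Polynomial.mapRingHom (Ideal.Quotient.mk (Ideal.span {Φ})) (poly (q' ^ (2 * d * L))) := by
      have hφ := map_rahmanSum (R := Polynomial A) (S := Polynomial (A ⧸ Ideal.span {Φ}))
        (Polynomial.mapRingHom (Ideal.Quotient.mk (Ideal.span {Φ})))
      refine (hφ _ _ _ _ _ _ _).trans (Eq.trans ?_ (hφ _ _ _ _ _ _ _).symm)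
      simp only [Polynomial.coe_mapRingHom, Polynomial.map_C, map_add, map_mul, ← hmk]
    rwa [hterm, map_zero] at hcongr
  have hroot : (poly q').eval (q ^ n + q' ^ n) = 0 := by
    refine Subtype.ext ?_
    rw [heval]
    simp only [q', q, AddMemClass.coe_add, SubmonoidClass.coe_pow, ZeroMemClass.coe_zero]
    have hs : qv * (qv ^ n + qv⁻¹ ^ n) * (qv ^ d) ^ N = 1 + qv ^ 2 * (qv ^ d) ^ (2 * N) := by
      rw [inv_pow, hN]
      field_simp
      ring
    have hnum (a E h : K2) :
        rahmanNum (qv ^ d) a E (qv ^ 2) h (qv * (qv ^ n + qv⁻¹ ^ n)) N = 0 := by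
      rw [rahmanNum, hs]; ring
    rw [rahmanSum_of_rahmanNum_eq_zero (hnum _ _ _) hNM]
    refine mul_eq_zero_of_left ?_ _
    have hag : qv⁻¹ = qv⁻¹ * qv⁻¹ ^ 2 * qv ^ 2 := by field_simp
    generalize ev + qv⁻¹ * qv ^ d / ev = E
    have key := rahmanSum_eq_zero_of_odd (pow_ne_zero d hq0) hQ hNodd
      (h := qv⁻¹ * qv⁻¹ ^ 2) ?_ hg ?_ hs E
    · rwa [← hag] at key
    · intro m
      have h1 : qv⁻¹ * qv⁻¹ ^ 2 * qv ^ 2 * (qv ^ d) ^ m = qv ^ ((d * m : ℤ) - 1) := by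
        rw [← hag, zpow_sub₀ hq0]
        norm_cast
        rw [pow_mul, pow_one]
        field_simp
      rw [h1]
      refine qv_zpow_ne_one fun h => ?_
      have h2 : d ∣ 1 := ⟨m, by zify; linarith⟩
      have := Nat.le_of_dvd one_pos h2
      omega
    · intro j _
      have h1 : qv⁻¹ * qv⁻¹ ^ 2 * (qv ^ d) ^ j = qv ^ ((d * j : ℤ) - 3) := by
        rw [zpow_sub₀ hq0]
        norm_cast
        rw [pow_mul]
        field_simp
      rw [h1]
      refine qv_zpow_ne_one fun h => ?_
      have h2 : 2 ∣ 3 := hdeven.two_dvd.trans ⟨j, by zify; linarith⟩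
      omega
  have htwo : Φ ^ 2 ∣ 2 - (q ^ n + q' ^ n) := by
    have hqqn : q ^ n * q' ^ n = 1 := by rw [← mul_pow, hqq, one_pow]
    refine (pow_dvd_pow_of_dvd hΦq 2).trans ⟨-q' ^ n, ?_⟩
    linear_combination (q ^ n - 2) * hqqn
  obtain ⟨y, hy⟩ := pow_three_dvd_eval hΦ0 hmap hroot htwo
  refine ⟨y, y.2, ?_⟩
  have h := congrArg Subtype.val hy
  rw [heval, show ((2 : A) : K2) = 2 from rfl] at h
  simpa [q', Φ, pow_succ'] using h

lemma rahmanDen_mem_cycloUnits {d n N M j : ℕ} (hd : 2 ≤ d) (hdeven : Even d)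
    (hN : n = d * N + 1) (hM : 2 * M ≤ d * N) (hj : j < M) :
    rahmanDen (qv ^ d) qv⁻¹ (ev + qv⁻¹ * qv ^ d / ev) (qv ^ 2) (qv⁻¹ ^ 3) (qv * 2) j ∈
      cycloUnits n := by
  have hn : 0 < n := by omega
  have hq0 := qv_ne_zero
  have hcop : IsCoprime (n : ℤ) (d : ℤ) := ⟨1, -N, by rw [hN]; push_cast; ring⟩
  have hcop2 : IsCoprime (n : ℤ) 2 := by
    obtain ⟨r, rfl⟩ := hdeven
    exact ⟨1, -(r * N), by rw [hN]; push_cast; ring⟩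
  have hdN : 2 * N ≤ d * N := Nat.mul_le_mul_right N hd
  have h1 : ¬ n ∣ d * (j + 1) := by
    intro h
    have h' : (n : ℤ) ∣ d * ((j + 1 : ℕ) : ℤ) := by exact_mod_cast h
    have := Nat.le_of_dvd (Nat.succ_pos j) (Int.natCast_dvd_natCast.1 (hcop.dvd_of_dvd_mul_left h'))
    omega
  have h2 : ¬ n ∣ 2 * (d * (j + 1) - 1) := by
    intro h
    have h' : (n : ℤ) ∣ 2 * ((d * (j + 1) - 1 : ℕ) : ℤ) := by exact_mod_cast h
    have h3 := hcop2.dvd_of_dvd_mul_left h'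
    have h4 : (n : ℤ) ∣ d * ((j + 1 + N : ℕ) : ℤ) := by
      have h5 := dvd_add h3 (dvd_refl (n : ℤ))
      have hpos : 1 ≤ d * (j + 1) := Nat.mul_pos (by omega) (Nat.succ_pos j)
      have h6 : (d : ℤ) * ((j + 1 + N : ℕ) : ℤ) = ((d * (j + 1) - 1 : ℕ) : ℤ) + n := by
        rw [hN]
        push_cast [hpos]
        ring
      rw [h6]
      exact h5
    have := Nat.le_of_dvd (by omega) (Int.natCast_dvd_natCast.1 (hcop.dvd_of_dvd_mul_left h4))
    omega
  have h3 : ¬ n ∣ d + 2 + 2 * d * j := by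
    intro h
    have h' : (n : ℤ) ∣ d + 2 + 2 * d * j := by exact_mod_cast h
    have h4 : (n : ℤ) ∣ d * (1 + 2 * j - 2 * N) := by
      have h5 := dvd_sub h' (dvd_mul_right (n : ℤ) 2)
      have h6 : (d : ℤ) * (1 + 2 * j - 2 * N) = d + 2 + 2 * d * j - n * 2 := by
        rw [hN]
        push_cast
        ring
      rw [h6]
      exact h5
    have h6 := Int.eq_zero_of_abs_lt_dvd (hcop.dvd_of_dvd_mul_left h4)
      (by rw [abs_lt]; constructor <;> omega)
    omega
  have e1 : 1 - qv ^ d * (qv ^ d) ^ j = 1 - qv ^ (d * (j + 1)) := by ring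
  have e2 : 1 - ev * (qv ^ d) ^ j = 1 - ev * qv ^ (d * j) := by rw [pow_mul]
  have e3 : 1 - qv⁻¹ * qv ^ d / ev * (qv ^ d) ^ j = 1 - qv ^ (d - 1 + d * j) / ev := by
    obtain ⟨r, rfl⟩ : ∃ r, d = r + 1 := ⟨d - 1, by omega⟩
    rw [pow_succ', inv_mul_cancel_left₀ hq0, Nat.add_sub_cancel]
    ring
  have e4 : 1 - qv⁻¹ ^ 2 * (qv ^ d) ^ 2 * ((qv ^ d) ^ 2) ^ j =
      1 - qv ^ (2 * (d * (j + 1) - 1)) := by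
    obtain ⟨r, hr⟩ : ∃ r, d * (j + 1) = r + 1 :=
      ⟨d * (j + 1) - 1, by have := Nat.mul_pos (by omega : 0 < d) (by omega : 0 < j + 1); omega⟩
    have h : (qv ^ d) ^ 2 * ((qv ^ d) ^ 2) ^ j = (qv ^ (r + 1)) ^ 2 := by rw [← hr]; ring
    rw [mul_assoc, h, ← mul_pow, pow_succ' qv r, inv_mul_cancel_left₀ hq0, hr, Nat.add_sub_cancel]
    ring
  have e5 : 1 - qv ^ 2 * qv ^ d * ((qv ^ d) ^ 2) ^ j = 1 - qv ^ (d + 2 + 2 * d * j) := by ring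
  rw [rahmanDen_eq hq0 ev_ne_zero, e1, e2, e3, e4, e5]
  have u2 := one_sub_qv_pow_mem_cycloUnits h2
  exact mul_mem (mul_mem (mul_mem (one_sub_qv_pow_mem_cycloUnits h1)
    (one_sub_ev_mul_qv_pow_mem_cycloUnits hn _)) (one_sub_qv_pow_div_ev_mem_cycloUnits hn _))
    (mul_mem (mul_mem u2 u2) (one_sub_qv_pow_mem_cycloUnits h3))

/-- Theorem 1.2: for even `d ≥ 2` and `n ≡ d+1 (mod 2d)`, with `M = (n-1)/2` if `d = 2`
and `M = (dn-n+1)/(2d)` otherwise,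
`Σ_{k=0}^{M} [3dk-1] (q^{-1},e,q^{d-1}/e;q^{2d})_k (q,q,q^{d-3};q^d)_k q^{dk} /
((q^d,e,q^{d-1}/e;q^d)_k (q^{2d-2},q^{2d-2},q^{d+2};q^{2d})_k) ≡ 0 (mod Φ_n(q)^3)`. -/
theorem stmt5 (d : ℕ) (hd2 : 2 ≤ d) (hdeven : Even d) (n : ℕ) (hn : 0 < n)
    (hmod : n % (2 * d) = (d + 1) % (2 * d))
    (M : ℕ) (hM : M = if d = 2 then (n - 1) / 2 else (d * n - n + 1) / (2 * d)) :
    CongrMod2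
      (∑ k ∈ Finset.range (M + 1),
        qInt qv (3 * (d : ℤ) * k - 1) *
          (qPoch (qv ^ (-1 : ℤ)) (qv ^ (2 * d)) k * qPoch ev (qv ^ (2 * d)) k *
            qPoch (qv ^ ((d : ℤ) - 1) / ev) (qv ^ (2 * d)) k) *
          (qPoch qv (qv ^ d) k * qPoch qv (qv ^ d) k * qPoch (qv ^ ((d : ℤ) - 3)) (qv ^ d) k) *
          qv ^ (d * k) /
          (qPoch (qv ^ d) (qv ^ d) k * qPoch ev (qv ^ d) k *
            qPoch (qv ^ ((d : ℤ) - 1) / ev) (qv ^ d) k *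
            (qPoch (qv ^ (2 * d - 2)) (qv ^ (2 * d)) k * qPoch (qv ^ (2 * d - 2)) (qv ^ (2 * d)) k *
              qPoch (qv ^ (d + 2)) (qv ^ (2 * d)) k)))
      0 (Phi2 n ^ 3) := by
  obtain ⟨c, ρ, hdρ, hnc⟩ : ∃ c ρ : ℕ, d = 2 * ρ + 2 ∧ n = d * (2 * c + 1) + 1 := by
    obtain ⟨r, hr⟩ := hdeven
    refine ⟨n / (2 * d), r - 1, by omega, ?_⟩
    rw [Nat.mod_eq_of_lt (by omega : d + 1 < 2 * d)] at hmod
    have h := Nat.div_add_mod n (2 * d)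
    rw [hmod] at h
    linarith
  have hL : 2 * d * (c * (2 * ρ + 1) + ρ + 1) = n * (d - 1) + 1 := by
    rw [hnc, hdρ, show 2 * ρ + 2 - 1 = 2 * ρ + 1 by omega]
    ring
  have hMle : 2 * c + 1 ≤ M ∧ c * (2 * ρ + 1) + ρ + 1 ≤ M ∧ 2 * M ≤ d * (2 * c + 1) := by
    rcases Nat.eq_zero_or_pos ρ with rfl | hρ
    · rw [if_pos (by omega)] at hM
      subst hdρ
      omega
    · rw [if_neg (by omega), show d * n - n + 1 = n * (d - 1) + 1 by
        rw [Nat.mul_sub_one, mul_comm], ← hL, Nat.mul_div_cancel_left _ (by omega)] at hM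
      subst hM hdρ
      exact ⟨by nlinarith, le_rfl, by nlinarith⟩
  obtain ⟨y, hy, hsum⟩ := rahmanSum_mem_Phi2_pow_three hd2 hdeven hnc ⟨c, rfl⟩ hMle.1 hMle.2.1 hL
  have hq0 := qv_ne_zero
  have he0 := ev_ne_zero
  have hDen (s : Finset ℕ) (hs : s ⊆ range M) :
      ∏ j ∈ s, rahmanDen (qv ^ d) qv⁻¹ (ev + qv⁻¹ * qv ^ d / ev) (qv ^ 2) (qv⁻¹ ^ 3) (qv * 2) j ∈
        cycloUnits n :=
    prod_mem fun j hj =>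
      rahmanDen_mem_cycloUnits hd2 hdeven hnc hMle.2.2 (mem_range.1 (hs hj))
  have hone : 1 - qv ∈ cycloUnits n := by
    rw [← pow_one qv]
    refine one_sub_qv_pow_mem_cycloUnits fun h => ?_
    have h1 := Nat.eq_one_of_dvd_one h
    have h2 := Nat.mul_pos (by omega : 0 < d) (Nat.succ_pos (2 * c))
    omega
  have hU := mul_mem hone (hDen (range M) subset_rfl)
  have hUy := mul_mem (inv_mem_cycloUnits hU).2.1 hy
  obtain ⟨f, g, hg, hp, hfg⟩ := hUy
  refine ⟨f, g, hg, fun p hpp hd hd' => hp p hpp hd (hpp.dvd_of_dvd_pow hd'), ?_⟩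
  rw [← hfg, map_pow, sub_zero, ← mul_assoc, ← mul_assoc]
  congr 1
  rw [mul_comm (_ ^ 3), mul_assoc, ← hsum, rahmanSum, mul_sum]
  refine sum_congr rfl fun k hk => ?_
  have hkM : k ≤ M := Nat.lt_succ_iff.1 (mem_range.1 hk)
  have z1 : qv ^ (3 * (d : ℤ) * k - 1) = qv⁻¹ * (qv ^ d) ^ (3 * k) := by
    rw [zpow_sub₀ hq0, zpow_one, div_eq_inv_mul]
    norm_cast
    ring
  have z2 : qv ^ ((d : ℤ) - 1) = qv⁻¹ * qv ^ d := by
    rw [zpow_sub₀ hq0, zpow_one, div_eq_inv_mul, zpow_natCast]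
  have z3 : qv ^ ((d : ℤ) - 3) = qv⁻¹ ^ 3 * qv ^ d := by
    rw [zpow_sub₀ hq0, div_eq_inv_mul, zpow_natCast, inv_pow]
    norm_cast
  have z4 : qv ^ (2 * d - 2) = qv⁻¹ ^ 2 * (qv ^ d) ^ 2 := by
    rw [pow_sub₀ _ hq0 (by omega), mul_comm, inv_pow]
    ring
  have z5 : qv ^ (d + 2) = qv ^ 2 * qv ^ d := by ring
  have z6 : qv ^ (2 * d) = (qv ^ d) ^ 2 := by ring
  have hsplit := prod_range_mul_prod_Ico
    (rahmanDen (qv ^ d) qv⁻¹ (ev + qv⁻¹ * qv ^ d / ev) (qv ^ 2) (qv⁻¹ ^ 3) (qv * 2)) hkM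
  have hk1 := (hDen (range k) (range_mono hkM)).1
  have hk2 := (hDen (Ico k M) fun j hj => mem_range.2 (mem_Ico.1 hj).2).1
  rw [← hsplit, qInt, z1, z2, z3, z4, z5, z6, zpow_neg_one, pow_mul qv d k,
    ← prod_rahmanDen_eq_qPoch hq0 he0, mul_assoc ((1 - _) / _), mul_assoc ((1 - _) / _),
    ← prod_rahmanNum_eq_qPoch hq0 he0]
  have h1q := hone.1
  generalize ∏ j ∈ range k, rahmanDen (qv ^ d) _ _ _ _ _ j = D₁ at hk1 ⊢
  generalize ∏ j ∈ Ico k M, rahmanDen (qv ^ d) _ _ _ _ _ j = D₂ at hk2 ⊢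
  field_simp

end
end
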